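/- Asymmetric fractional Euler-Lagrange equation (1D time case): let L(t,y,v) be C¹ and u ∈ AC²([a,b]) be such that t ↦ ∂_v L(t, u(t), ᶜD₊^{1/2}u(t)) is in AC¹([a,b]). Then ∫_a^b [∂_y L(t,u,ᶜD₊^{1/2}u) h(t) + ∂_v L(t,u,ᶜD₊^{1/2}u) (−ᶜD₋^{1/2} h)(t)] dt = 0 for all h ∈ C¹([a,b]) with h(a)=h(b)=0 if and only if ∂_y L(t,u(t),ᶜD₊^{1/2}u(t)) − D₊^{1/2}[∂_v L(·,u,ᶜD₊^{1/2}u)](t) = 0 for all t ∈ (a,b). -/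

import Mathlib

open MeasureTheory intervalIntegral Set

/-- Left Riemann-Liouville fractional integral on `[a, ·]`. -/
noncomputable def fracInt (a β : ℝ) (f : ℝ → ℝ) (t : ℝ) : ℝ :=
  (1 / Real.Gamma β) * ∫ τ in a..t, (t - τ) ^ (β - 1) * f τ

/-- Left Riemann-Liouville fractional derivative of order `α ∈ [0,1)`. -/
noncomputable def rlDeriv (a α : ℝ) (f : ℝ → ℝ) : ℝ → ℝ :=
  deriv (fracInt a (1 - α) f)

/-- Left Caputo fractional derivative of order `α ∈ [0,1)`. -/
noncomputable def caputoDeriv (a α : ℝ) (f : ℝ → ℝ) : ℝ → ℝ :=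
  fracInt a (1 - α) (deriv f)

/-- Right Riemann-Liouville fractional integral on `[·, b]`. -/
noncomputable def fracIntR (b β : ℝ) (f : ℝ → ℝ) (t : ℝ) : ℝ :=
  (1 / Real.Gamma β) * ∫ τ in t..b, (τ - t) ^ (β - 1) * f τ

/-- Right Riemann-Liouville fractional derivative of order `α ∈ [0,1)`. -/
noncomputable def rlDerivR (b α : ℝ) (f : ℝ → ℝ) (t : ℝ) : ℝ :=
  - deriv (fracIntR b (1 - α) f) t

/-- Right Caputo fractional derivative of order `α ∈ [0,1)`. -/
noncomputable def caputoDerivR (b α : ℝ) (f : ℝ → ℝ) (t : ℝ) : ℝ :=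
  - fracIntR b (1 - α) (deriv f) t

/-- Truncated power kernel. -/
noncomputable def powKer (a b p : ℝ) : ℝ → ℝ :=
  (Ioc 0 (b - a)).indicator (fun x => x ^ p)

lemma powKer_integrable (a b p : ℝ) (hp : -1 < p) : Integrable (powKer a b p) := by
  unfold powKer
  rw [integrable_indicator_iff measurableSet_Ioc]
  exact (intervalIntegrable_rpow' (a := 0) (b := b - a) hp).1

lemma powKer_left (a b p : ℝ) (hp0 : p ≠ 0) (f : ℝ → ℝ) (r : ℝ) (hr : r ∈ Ioc a b) :
    ∫ s, powKer a b p (r - s) * (Ioc a b).indicator f s = ∫ s in a..r, (r - s) ^ p * f s := by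
  rw [intervalIntegral.integral_of_le hr.1.le, ← MeasureTheory.integral_indicator measurableSet_Ioc]
  congr 1
  ext s
  obtain ⟨h1, h2⟩ := hr
  by_cases hs : s ∈ Ioc a r
  · rw [indicator_of_mem hs, indicator_of_mem (show s ∈ Ioc a b from ⟨hs.1, hs.2.trans h2⟩)]
    congr 1
    unfold powKer
    rcases eq_or_lt_of_le hs.2 with h | h
    · rw [h, sub_self, Real.zero_rpow hp0, indicator_of_notMem (by simp)]
    · rw [indicator_of_mem (show r - s ∈ Ioc 0 (b - a) from ⟨by linarith, by linarith [hs.1]⟩)]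
  · rw [indicator_of_notMem hs]
    by_cases hs1 : s ≤ a
    · rw [indicator_of_notMem (fun h => absurd h.1 (not_lt.2 hs1)), mul_zero]
    · have : r < s := by
        by_contra hh
        exact hs ⟨not_le.1 hs1, not_lt.1 hh⟩
      unfold powKer
      rw [indicator_of_notMem (fun h => by have := h.1; linarith), zero_mul]

lemma powKer_right (a b p : ℝ) (hp0 : p ≠ 0) (f : ℝ → ℝ) (r : ℝ) (hr : r ∈ Ioc a b) :
    ∫ s, powKer a b p (s - r) * (Ioc a b).indicator f s = ∫ s in r..b, (s - r) ^ p * f s := by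
  rw [intervalIntegral.integral_of_le hr.2, ← MeasureTheory.integral_indicator measurableSet_Ioc]
  congr 1
  ext s
  obtain ⟨h1, h2⟩ := hr
  by_cases hs : s ∈ Ioc r b
  · rw [indicator_of_mem hs, indicator_of_mem (show s ∈ Ioc a b from ⟨h1.trans hs.1, hs.2⟩)]
    congr 1
    unfold powKer
    rw [indicator_of_mem (show s - r ∈ Ioc 0 (b - a) from ⟨by linarith [hs.1], by linarith [hs.2]⟩)]
  · rw [indicator_of_notMem hs]
    by_cases hs1 : b < s
    · rw [indicator_of_notMem (fun h => absurd h.2 (not_le.2 hs1)), mul_zero]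
    · have : s ≤ r := by
        by_contra hh
        exact hs ⟨not_le.1 hh, not_lt.1 hs1⟩
      unfold powKer
      rw [indicator_of_notMem (fun h => by have := h.1; linarith), zero_mul]

/-- Fractional integration by parts. -/
lemma frac_parts (a b p : ℝ) (hab : a < b) (hp : -1 < p) (hp0 : p ≠ 0) (φ k : ℝ → ℝ)
    (hφ : ContinuousOn φ (Icc a b)) (hk : ContinuousOn k (Icc a b)) :
    IntervalIntegrable (fun t => φ t * ∫ τ in t..b, (τ - t) ^ p * k τ) volume a b ∧
    ∫ t in a..b, φ t * ∫ τ in t..b, (τ - t) ^ p * k τ =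
      ∫ τ in a..b, (∫ t in a..τ, (τ - t) ^ p * φ t) * k τ := by
  have hφi : Integrable ((Ioc a b).indicator φ) := by
    rw [integrable_indicator_iff measurableSet_Ioc]
    exact (hφ.integrableOn_Icc).mono_set Ioc_subset_Icc_self
  have hki : Integrable ((Ioc a b).indicator k) := by
    rw [integrable_indicator_iff measurableSet_Ioc]
    exact (hk.integrableOn_Icc).mono_set Ioc_subset_Icc_self
  obtain ⟨C, hC⟩ := isCompact_Icc.exists_bound_of_continuousOn hk
  have hC0 : 0 ≤ C := (norm_nonneg _).trans (hC a ⟨le_rfl, hab.le⟩)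
  have hC' : ∀ x, ‖(Ioc a b).indicator k x‖ ≤ C := by
    intro x
    by_cases hx : x ∈ Ioc a b
    · rw [indicator_of_mem hx]; exact hC x (Ioc_subset_Icc_self hx)
    · rw [indicator_of_notMem hx]; simpa using hC0
  have hI := hφi.convolution_integrand (ContinuousLinearMap.mul ℝ ℝ) (powKer_integrable a b p hp)
  have hI2 := hI.mul_bdd (g := fun q : ℝ × ℝ => (Ioc a b).indicator k q.1) (c := C)
    (hki.aestronglyMeasurable.comp_fst) (Filter.Eventually.of_forall fun q => hC' q.1)
  simp only [ContinuousLinearMap.mul_apply'] at hI2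
  have e1 : ∀ t, ∫ τ, (Ioc a b).indicator φ t * powKer a b p (τ - t) * (Ioc a b).indicator k τ
      = (Ioc a b).indicator (fun t => φ t * ∫ τ in t..b, (τ - t) ^ p * k τ) t := by
    intro t
    simp only [mul_assoc]
    rw [MeasureTheory.integral_const_mul]
    by_cases ht : t ∈ Ioc a b
    · rw [indicator_of_mem ht, indicator_of_mem ht, powKer_right a b p hp0 k t ht]
    · rw [indicator_of_notMem ht, indicator_of_notMem ht, zero_mul]
  have e2 : ∀ τ, ∫ t, (Ioc a b).indicator φ t * powKer a b p (τ - t) * (Ioc a b).indicator k τ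
      = (Ioc a b).indicator (fun τ => (∫ t in a..τ, (τ - t) ^ p * φ t) * k τ) τ := by
    intro τ
    rw [MeasureTheory.integral_mul_const]
    by_cases ht : τ ∈ Ioc a b
    · rw [indicator_of_mem ht, indicator_of_mem ht, ← powKer_left a b p hp0 φ τ ht]
      simp only [mul_comm]
    · rw [indicator_of_notMem ht, indicator_of_notMem ht, mul_zero]
  constructor
  · rw [intervalIntegrable_iff_integrableOn_Ioc_of_le hab.le, ← integrable_indicator_iff measurableSet_Ioc]
    have := hI2.integral_prod_right
    simpa only [e1] using this
  · have := MeasureTheory.integral_integral_swap (f := fun τ t => (Ioc a b).indicator φ t * powKer a b p (τ - t) * (Ioc a b).indicator k τ) hI2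
    simp only [e1, e2] at this
    rw [MeasureTheory.integral_indicator measurableSet_Ioc, MeasureTheory.integral_indicator measurableSet_Ioc] at this
    rw [intervalIntegral.integral_of_le hab.le, intervalIntegral.integral_of_le hab.le]
    exact this.symm

lemma ind_int (a b c τ : ℝ) (f : ℝ → ℝ) (hc : c ≤ a) (h1 : a ≤ τ) (h2 : τ ≤ b) :
    ∫ s in c..τ, (Ioc a b).indicator f s = ∫ s in a..τ, f s := by
  rw [intervalIntegral.integral_of_le (hc.trans h1), intervalIntegral.integral_of_le h1,
    MeasureTheory.setIntegral_indicator measurableSet_Ioc, Ioc_inter_Ioc,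
    max_eq_right hc, min_eq_left h2]

lemma frac_AC0 (a b p : ℝ) (hab : a < b) (hp : -1 < p) (hp0 : p ≠ 0) (f : ℝ → ℝ)
    (hf : IntervalIntegrable f volume a b) :
    IntervalIntegrable (fun r => ∫ s in a..r, (r - s) ^ p * f s) volume a b ∧
    ∀ t ∈ Icc a b, ∫ τ in a..t, (t - τ) ^ p * (∫ s in a..τ, f s) =
      ∫ r in a..t, ∫ s in a..r, (r - s) ^ p * f s := by
  have hfi : Integrable ((Ioc a b).indicator f) := by
    rw [integrable_indicator_iff measurableSet_Ioc]
    exact hf.1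
  have hI := (powKer_integrable a b p hp).convolution_integrand (ContinuousLinearMap.mul ℝ ℝ) hfi
  simp only [ContinuousLinearMap.mul_apply'] at hI
  have e1 : ∀ r ∈ Ioc a b, ∫ x, powKer a b p x * (Ioc a b).indicator f (r - x) =
      ∫ s in a..r, (r - s) ^ p * f s := by
    intro r hr
    rw [← powKer_left a b p hp0 f r hr, ← MeasureTheory.integral_sub_left_eq_self _ volume r]
    simp only [sub_sub_cancel]
  constructor
  · rw [intervalIntegrable_iff_integrableOn_Ioc_of_le hab.le]
    have := hI.integral_prod_left
    refine (this.integrableOn (s := Ioc a b)).congr_fun ?_ measurableSet_Ioc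
    intro r hr
    exact e1 r hr
  · intro t ht
    have hsw := MeasureTheory.integral_integral_swap (μ := volume.restrict (Ioc a t)) (ν := volume)
      (f := fun r x => powKer a b p x * (Ioc a b).indicator f (r - x)) (by
        refine hI.mono_measure ?_
        exact Measure.prod_mono Measure.restrict_le_self le_rfl)
    have l1 : ∫ r in Ioc a t, ∫ x, powKer a b p x * (Ioc a b).indicator f (r - x) =
        ∫ r in a..t, ∫ s in a..r, (r - s) ^ p * f s := by
      rw [intervalIntegral.integral_of_le ht.1]
      refine setIntegral_congr_fun measurableSet_Ioc ?_
      intro r hr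
      exact e1 r ⟨hr.1, hr.2.trans ht.2⟩
    rw [← l1, hsw, ← MeasureTheory.integral_sub_left_eq_self _ volume t,
      intervalIntegral.integral_of_le ht.1, ← MeasureTheory.integral_indicator measurableSet_Ioc]
    congr 1
    ext τ
    rw [MeasureTheory.integral_const_mul, ← intervalIntegral.integral_of_le ht.1,
      intervalIntegral.integral_comp_sub_right, sub_sub_cancel]
    by_cases hτ : τ ∈ Ioc a t
    · rw [indicator_of_mem hτ, ind_int a b _ τ f (by linarith [hτ.2]) hτ.1.le (hτ.2.trans ht.2)]
      congr 1
      unfold powKer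
      rcases eq_or_lt_of_le hτ.2 with h | h
      · rw [h, sub_self, Real.zero_rpow hp0, indicator_of_notMem (by simp)]
      · rw [indicator_of_mem (show t - τ ∈ Ioc 0 (b - a) from ⟨by linarith, by linarith [hτ.1, ht.2]⟩)]
    · rw [indicator_of_notMem hτ]
      by_cases h1 : τ ≤ a
      · have : ∫ s in (a - (t - τ))..τ, (Ioc a b).indicator f s = ∫ s in (a - (t - τ))..τ, (0:ℝ) := by
          refine intervalIntegral.integral_congr ?_
          intro s hs
          rw [uIcc_of_le (by linarith [ht.1, h1, ht.2] : a - (t - τ) ≤ τ)] at hs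
          exact indicator_of_notMem (fun h => by have := h.1; linarith [hs.2]) _
        rw [this]; simp
      · have : t < τ := by
          by_contra hh
          exact hτ ⟨not_le.1 h1, not_lt.1 hh⟩
        unfold powKer
        rw [indicator_of_notMem (fun h => by have := h.1; linarith), zero_mul]

lemma fracInt_AC (a b β : ℝ) (hab : a < b) (hβ : 0 < β) (hβ1 : β ≠ 1) (ψ ψ' : ℝ → ℝ) (c : ℝ)
    (hψ' : IntervalIntegrable ψ' volume a b)
    (hψ : ∀ t ∈ Icc a b, ψ t = c + ∫ s in a..t, ψ' s) :
    ∃ g, IntervalIntegrable g volume a b ∧ ∀ t ∈ Icc a b, fracInt a β ψ t = ∫ s in a..t, g s := by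
  have hp : -1 < β - 1 := by linarith
  obtain ⟨h1, h2⟩ := frac_AC0 a b (β - 1) hab hp (sub_ne_zero.2 hβ1) ψ' hψ'
  have h3 : IntervalIntegrable (fun r => (r - a) ^ (β - 1)) volume a b := by
    have := (intervalIntegrable_rpow' (a := 0) (b := b - a) hp).comp_sub_right a
    simpa using this
  refine ⟨fun r => (1 / Real.Gamma β) * (c * (r - a) ^ (β - 1) + ∫ s in a..r, (r - s) ^ (β - 1) * ψ' s),
    ((h3.const_mul c).add h1).const_mul _, ?_⟩
  intro t ht
  have hsub : uIcc a t ⊆ uIcc a b := by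
    rw [uIcc_of_le ht.1, uIcc_of_le hab.le]; exact Icc_subset_Icc_right ht.2
  have i4 : IntervalIntegrable (fun τ => (t - τ) ^ (β - 1)) volume a t := by
    have := (intervalIntegrable_rpow' (a := t - a) (b := 0) hp).comp_sub_left t
    simpa using this
  have hcont : ContinuousOn (fun τ => ∫ s in a..τ, ψ' s) (uIcc a t) := by
    refine (intervalIntegral.continuousOn_primitive_interval' hψ' left_mem_uIcc).mono hsub
  unfold fracInt
  rw [intervalIntegral.integral_const_mul, intervalIntegral.integral_add
    ((h3.const_mul c).mono_set hsub) (h1.mono_set hsub), ← h2 t ht]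
  congr 1
  have e : ∫ τ in a..t, (t - τ) ^ (β - 1) * ψ τ =
      ∫ τ in a..t, ((t - τ) ^ (β - 1) * c + (t - τ) ^ (β - 1) * ∫ s in a..τ, ψ' s) := by
    refine intervalIntegral.integral_congr ?_
    intro τ hτ
    rw [uIcc_of_le ht.1] at hτ
    simp only
    rw [hψ τ ⟨hτ.1, hτ.2.trans ht.2⟩, mul_add]
  rw [e, intervalIntegral.integral_add (i4.mul_const c) (i4.mul_continuousOn hcont)]
  congr 1
  rw [intervalIntegral.integral_mul_const, intervalIntegral.integral_const_mul, mul_comm]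
  congr 1
  rw [intervalIntegral.integral_comp_sub_left (fun x => x ^ (β - 1)),
    intervalIntegral.integral_comp_sub_right (fun x => x ^ (β - 1))]
  simp

lemma partial_y_cont (L Ly : ℝ → ℝ → ℝ → ℝ)
    (hL : ContDiff ℝ 1 (fun p : ℝ × ℝ × ℝ => L p.1 p.2.1 p.2.2))
    (hLy : ∀ t y v, HasDerivAt (fun y' => L t y' v) (Ly t y v) y) :
    Continuous (fun p : ℝ × ℝ × ℝ => Ly p.1 p.2.1 p.2.2) := by
  have h : (fun p : ℝ × ℝ × ℝ => Ly p.1 p.2.1 p.2.2) =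
      fun p => fderiv ℝ (fun p : ℝ × ℝ × ℝ => L p.1 p.2.1 p.2.2) p (0, 1, 0) := by
    ext ⟨t, y, v⟩
    have h1 := (hL.differentiable (by norm_num) (t, y, v)).hasFDerivAt
    have h2 : HasDerivAt (fun y' : ℝ => ((t, y', v) : ℝ × ℝ × ℝ)) (0, 1, 0) y :=
      (hasDerivAt_const y t).prodMk ((hasDerivAt_id y).prodMk (hasDerivAt_const y v))
    have h3 := HasFDerivAt.comp_hasDerivAt (l := fun p : ℝ × ℝ × ℝ => L p.1 p.2.1 p.2.2)
      (f := fun y' : ℝ => ((t, y', v) : ℝ × ℝ × ℝ)) y h1 h2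
    exact (hLy t y v).unique h3
  rw [h]
  exact (hL.continuous_fderiv (by norm_num)).clm_apply continuous_const

/-- Continuous extension. -/
lemma exists_ext (a b : ℝ) (hab : a < b) (f : ℝ → ℝ) (hf : ContinuousOn f (Icc a b)) :
    ∃ g : ℝ → ℝ, Continuous g ∧ ∀ t ∈ Icc a b, g t = f t := by
  refine ⟨IccExtend hab.le ((Icc a b).domRestrict f), (continuousOn_iff_continuous_domRestrict.1 hf).Icc_extend', ?_⟩
  intro t ht
  rw [IccExtend_of_mem _ _ ht]; rfl

/-- du Bois-Reymond. -/
lemma dubois (a b : ℝ) (hab : a < b) (W : ℝ → ℝ) (hW : Continuous W)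
    (H : ∀ h h' : ℝ → ℝ, (∀ t ∈ Icc a b, HasDerivAt h (h' t) t) →
      ContinuousOn h' (Icc a b) → h a = 0 → h b = 0 → ∫ t in a..b, W t * h' t = 0) :
    ∃ m, ∀ t ∈ Icc a b, W t = m := by
  set m := (∫ t in a..b, W t) / (b - a) with hm
  have hba : b - a ≠ 0 := by linarith
  have hz : ∫ t in a..b, (W t - m) = 0 := by
    rw [intervalIntegral.integral_sub (hW.intervalIntegrable _ _) intervalIntegrable_const]
    simp only [intervalIntegral.integral_const, smul_eq_mul, hm]
    field_simp
    ring
  have hWm : Continuous (fun t => W t - m) := hW.sub continuous_const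
  have h1 := H (fun t => ∫ s in a..t, (W s - m)) (fun t => W t - m)
    (fun t _ => hWm.integral_hasStrictDerivAt a t |>.hasDerivAt) hWm.continuousOn (by simp) hz
  have h2 : ∫ t in a..b, (W t - m) ^ 2 = 0 := by
    have : ∫ t in a..b, (W t - m) ^ 2 = ∫ t in a..b, (W t * (W t - m) - m * (W t - m)) := by
      congr 1; ext t; ring
    have c1 : Continuous (fun t => W t * (W t - m)) := by fun_prop
    have c2 : Continuous (fun t => m * (W t - m)) := by fun_prop
    rw [this, intervalIntegral.integral_sub (c1.intervalIntegrable _ _)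
      (c2.intervalIntegrable _ _), h1,
      intervalIntegral.integral_const_mul, hz]
    simp
  refine ⟨m, fun t ht => ?_⟩
  by_contra hne
  have c3 : Continuous (fun t => (W t - m) ^ 2) := by fun_prop
  have := intervalIntegral.integral_pos hab c3.continuousOn (fun x _ => sq_nonneg _)
    ⟨t, ht, by have := sub_ne_zero.2 hne; positivity⟩
  linarith

/-- asymmetric fractional Euler-Lagrange equation (1D time case):
for a `C¹` Lagrangian `L(t,y,v)` and `u ∈ AC²([a,b])` with
`t ↦ ∂ᵥL(t,u,ᶜD₊^{1/2}u) ∈ AC¹`, the variational condition in directions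
`h ∈ C¹₀` holds iff `∂_y L - D₊^{1/2}[∂ᵥ L] = 0` on `(a,b)`. -/
theorem asymmetric_euler_lagrange (a b : ℝ) (hab : a < b)
    (L Ly Lv : ℝ → ℝ → ℝ → ℝ)
    (hL : ContDiff ℝ 1 (fun p : ℝ × ℝ × ℝ => L p.1 p.2.1 p.2.2))
    (hLy : ∀ t y v, HasDerivAt (fun y' => L t y' v) (Ly t y v) y)
    (hLv : ∀ t y v, HasDerivAt (fun v' => L t y v') (Lv t y v) v)
    (u u' u'' : ℝ → ℝ)
    (hu1 : ∀ t ∈ Set.Icc a b, HasDerivAt u (u' t) t)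
    (hu2 : IntervalIntegrable u'' volume a b)
    (hu3 : ∀ t ∈ Set.Icc a b, u' t = u' a + ∫ s in a..t, u'' s)
    (φ' : ℝ → ℝ)
    (hφ'int : IntervalIntegrable φ' volume a b)
    (hφAC : ∀ t ∈ Set.Icc a b,
      Lv t (u t) (caputoDeriv a (1/2) u t)
        = Lv a (u a) (caputoDeriv a (1/2) u a) + ∫ s in a..t, φ' s) :
    (∀ h h' : ℝ → ℝ,
      (∀ t ∈ Set.Icc a b, HasDerivAt h (h' t) t) →
      ContinuousOn h' (Set.Icc a b) → h a = 0 → h b = 0 →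
      (∫ t in a..b,
        (Ly t (u t) (caputoDeriv a (1/2) u t) * h t
          + Lv t (u t) (caputoDeriv a (1/2) u t) * (- caputoDerivR b (1/2) h t))) = 0)
    ↔ ∀ t ∈ Set.Ioo a b,
        Ly t (u t) (caputoDeriv a (1/2) u t)
          - rlDeriv a (1/2) (fun s => Lv s (u s) (caputoDeriv a (1/2) u s)) t = 0 := by

  have hLyc := partial_y_cont L Ly hL hLy
  -- continuity of the Caputo derivative of u
  have hu'c : ContinuousOn u (Icc a b) := fun t ht => (hu1 t ht).continuousAt.continuousWithinAt
  have hDc : ContinuousOn (caputoDeriv a (1/2) u) (Icc a b) := by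
    obtain ⟨g, hg, hg2⟩ := fracInt_AC a b (1 - 1/2) hab (by norm_num) (by norm_num) (deriv u) u'' (u' a) hu2
      (fun t ht => by rw [(hu1 t ht).deriv]; exact hu3 t ht)
    have := intervalIntegral.continuousOn_primitive_interval' hg left_mem_uIcc
    rw [uIcc_of_le hab.le] at this
    exact this.congr hg2
  have hℓc : ContinuousOn (fun t => Ly t (u t) (caputoDeriv a (1/2) u t)) (Icc a b) :=
    hLyc.comp_continuousOn (continuousOn_id.prodMk (hu'c.prodMk hDc))
  obtain ⟨g, hg, hFg⟩ := fracInt_AC a b (1 - 1/2) hab (by norm_num) (by norm_num)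
    (fun s => Lv s (u s) (caputoDeriv a (1/2) u s)) φ' _ hφ'int hφAC
  have hφc : ContinuousOn (fun s => Lv s (u s) (caputoDeriv a (1/2) u s)) (Icc a b) := by
    have := intervalIntegral.continuousOn_primitive_interval' hφ'int left_mem_uIcc
    rw [uIcc_of_le hab.le] at this
    exact (continuousOn_const.add this).congr hφAC
  unfold rlDeriv
  generalize hℓ : (fun t => Ly t (u t) (caputoDeriv a (1/2) u t)) = ℓ at *
  generalize hφ : (fun s => Lv s (u s) (caputoDeriv a (1/2) u s)) = φ at *
  have hℓt : ∀ t, Ly t (u t) (caputoDeriv a (1/2) u t) = ℓ t := fun t => congrFun hℓ t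
  have hφt : ∀ t, Lv t (u t) (caputoDeriv a (1/2) u t) = φ t := fun t => congrFun hφ t
  simp only [hℓt, hφt]
  clear hφt hℓt hℓ hφ hφAC hφ'int hDc hu'c hLyc hu1 hu2 hu3 hL hLy hLv
  set F := fracInt a (1 - 1/2) φ with hF
  have hFc : ContinuousOn F (Icc a b) := by
    have := intervalIntegral.continuousOn_primitive_interval' hg left_mem_uIcc
    rw [uIcc_of_le hab.le] at this
    exact this.congr hFg
  obtain ⟨ℓe, hℓec, hℓe⟩ := exists_ext a b hab ℓ hℓc
  obtain ⟨Fe, hFec, hFe⟩ := exists_ext a b hab F hFc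
  set Y : ℝ → ℝ := fun t => ∫ s in a..t, ℓe s with hY
  have hYd : ∀ t, HasDerivAt Y (ℓe t) t := fun t => (hℓec.integral_hasStrictDerivAt a t).hasDerivAt
  have hYc : Continuous Y := continuous_iff_continuousAt.2 fun t => (hYd t).continuousAt
  have key : ∀ h h' : ℝ → ℝ, (∀ t ∈ Icc a b, HasDerivAt h (h' t) t) →
      ContinuousOn h' (Icc a b) → h a = 0 → h b = 0 →
      ∫ t in a..b, (ℓ t * h t + φ t * (- caputoDerivR b (1/2) h t)) =
        ∫ t in a..b, (Fe t - Y t) * h' t := by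
    intro h h' hd hc ha hb
    have hhc : ContinuousOn h (Icc a b) := fun t ht => (hd t ht).continuousAt.continuousWithinAt
    obtain ⟨p1, p2⟩ := frac_parts a b (1 - 1/2 - 1) hab (by norm_num) (by norm_num) φ h' hφc hc
    have huI : uIcc a b = Icc a b := uIcc_of_le hab.le
    have ih' : IntervalIntegrable h' volume a b := ContinuousOn.intervalIntegrable (by rwa [huI])
    have ib := intervalIntegral.integral_mul_deriv_eq_deriv_mul (a := a) (b := b) (u := Y) (v := h)
      (u' := ℓe) (v' := h') (fun t _ => hYd t) (fun t ht => hd t (huI ▸ ht))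
      (hℓec.intervalIntegrable _ _) ih'
    rw [ha, hb] at ib
    have e1 : ∫ t in a..b, (ℓ t * h t + φ t * (- caputoDerivR b (1/2) h t)) =
        ∫ t in a..b, (ℓe t * h t + (1 / Real.Gamma (1 - 1/2)) *
          (φ t * ∫ τ in t..b, (τ - t) ^ ((1:ℝ) - 1/2 - 1) * h' τ)) := by
      refine intervalIntegral.integral_congr ?_
      intro t ht
      rw [huI] at ht
      simp only [caputoDerivR, fracIntR]
      rw [hℓe t ht]
      have : ∫ τ in t..b, (τ - t) ^ ((1:ℝ) - 1/2 - 1) * deriv h τ =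
          ∫ τ in t..b, (τ - t) ^ ((1:ℝ) - 1/2 - 1) * h' τ := by
        refine intervalIntegral.integral_congr ?_
        intro τ hτ
        rw [uIcc_of_le ht.2] at hτ
        simp only
        rw [(hd τ ⟨ht.1.trans hτ.1, hτ.2⟩).deriv]
      rw [this]
      ring
    have e2 : ∫ t in a..b, (Fe t - Y t) * h' t =
        ∫ t in a..b, ((1 / Real.Gamma (1 - 1/2)) *
          ((∫ τ in a..t, (t - τ) ^ ((1:ℝ) - 1/2 - 1) * φ τ) * h' t) - Y t * h' t) := by
      refine intervalIntegral.integral_congr ?_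
      intro t ht
      rw [huI] at ht
      simp only
      rw [hFe t ht, hF]
      simp only [fracInt]
      ring
    have i1 : IntervalIntegrable (fun t => (1 / Real.Gamma (1 - 1/2)) *
          ((∫ τ in a..t, (t - τ) ^ ((1:ℝ) - 1/2 - 1) * φ τ) * h' t)) volume a b := by
      refine ContinuousOn.intervalIntegrable ?_
      rw [huI]
      refine (hFc.mul hc).congr ?_
      intro t ht
      simp only [hF, fracInt, Pi.mul_apply]
      ring
    have i2 : IntervalIntegrable (fun t => Y t * h' t) volume a b := 
      ih'.continuousOn_mul hYc.continuousOn
    have i3 : IntervalIntegrable (fun t => ℓe t * h t) volume a b := by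
      refine ContinuousOn.intervalIntegrable ?_
      rw [huI]
      exact hℓec.continuousOn.mul hhc
    rw [e1, e2, intervalIntegral.integral_add i3 (p1.const_mul _), intervalIntegral.integral_sub i1 i2,
      intervalIntegral.integral_const_mul, intervalIntegral.integral_const_mul, p2, ib]
    ring
  constructor
  · intro H t ht
    obtain ⟨m, hm⟩ := dubois a b hab (fun t => Fe t - Y t) (hFec.sub hYc)
      (fun h h' h1 h2 h3 h4 => by rw [← key h h' h1 h2 h3 h4]; exact H h h' h1 h2 h3 h4)
    have hev : F =ᶠ[nhds t] fun s => Y s + m := by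
      filter_upwards [Ioo_mem_nhds ht.1 ht.2] with s hs
      have hs' := Ioo_subset_Icc_self hs
      have := hm s hs'
      rw [← hFe s hs']
      linarith
    rw [hev.deriv_eq, ((hYd t).add_const m).deriv, hℓe t (Ioo_subset_Icc_self ht), sub_self]
  · intro H h h' h1 h2 h3 h4
    rw [key h h' h1 h2 h3 h4]
    have hae : ∀ᵐ x, x ∈ Ioo a b → g x = ℓe x := by
      filter_upwards [hg.ae_hasDerivAt_integral] with x hx hxI
      have hd := hx (by rw [uIcc_of_le hab.le]; exact Ioo_subset_Icc_self hxI) a left_mem_uIcc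
      have hev : F =ᶠ[nhds x] fun s => ∫ r in a..s, g r := by
        filter_upwards [Ioo_mem_nhds hxI.1 hxI.2] with s hs
        exact hFg s (Ioo_subset_Icc_self hs)
      have := H x hxI
      rw [hev.deriv_eq, hd.deriv] at this
      rw [hℓe x (Ioo_subset_Icc_self hxI)]
      linarith
    have hFY : ∀ t ∈ Icc a b, Fe t = Y t := by
      intro t ht
      rw [hFe t ht, hFg t ht]
      refine intervalIntegral.integral_congr_ae ?_
      have hb : ∀ᵐ x : ℝ, x ≠ b := by simp [ae_iff]
      filter_upwards [hae, hb] with x hx hxb hxt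
      rw [uIoc_of_le ht.1] at hxt
      exact hx ⟨hxt.1, lt_of_le_of_ne (hxt.2.trans ht.2) hxb⟩
    have : ∫ t in a..b, (Fe t - Y t) * h' t = ∫ t in a..b, (0:ℝ) := by
      refine intervalIntegral.integral_congr ?_
      intro t ht
      rw [uIcc_of_le hab.le] at ht
      simp only
      rw [hFY t ht, sub_self, zero_mul]
    rw [this]; simp
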